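/- One full round of the alternating scheme does not increase the two-sided approximation error: let A : Fin M → Fin N → ℝ, B : Fin M → Fin L → ℝ, x : Fin N → ℝ and y : Fin L → ℝ with M, N, L ≥ 1. Define y' : Fin L → ℝ by y' l = Δ(B, A ⊗ x)/2 + x̄(B, A ⊗ x) l, and x' : Fin N → ℝ by x' j = Δ(A, B ⊗ y')/2 + x̄(A, B ⊗ y') j. Then d(A ⊗ x', B ⊗ y') ≤ d(A ⊗ x, B ⊗ y') ≤ d(A ⊗ x, B ⊗ y). -/

import Mathlib

open Finset

/-- Finite maximum over `Fin n` (nonempty since `NeZero n`). -/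
noncomputable def fmax {n : ℕ} [NeZero n] (f : Fin n → ℝ) : ℝ :=
  Finset.univ.sup' Finset.univ_nonempty f

/-- Finite minimum over `Fin n`. -/
noncomputable def fmin {n : ℕ} [NeZero n] (f : Fin n → ℝ) : ℝ :=
  Finset.univ.inf' Finset.univ_nonempty f

/-- Max-plus matrix-vector product: `(A ⊗ x) i = max_j (A i j + x j)`. -/
noncomputable def mp {M N : ℕ} [NeZero N] (A : Fin M → Fin N → ℝ) (x : Fin N → ℝ) :
    Fin M → ℝ :=
  fun i => fmax (fun j => A i j + x j)

/-- Tropical (Chebyshev) distance. -/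
noncomputable def dd {M : ℕ} [NeZero M] (u v : Fin M → ℝ) : ℝ :=
  fmax (fun i => |u i - v i|)

/-- Residual `Δ(A, b)`. -/
noncomputable def resid {M N : ℕ} [NeZero M] [NeZero N]
    (A : Fin M → Fin N → ℝ) (b : Fin M → ℝ) : ℝ :=
  fmax (fun i => b i - fmax (fun j => A i j + fmin (fun k => b k - A k j)))

/-- Principal solution `x̄(A, b) j = min_i (b i − A i j)`. -/
noncomputable def xbar {M N : ℕ} [NeZero M]
    (A : Fin M → Fin N → ℝ) (b : Fin M → ℝ) : Fin N → ℝ :=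
  fun j => fmin (fun i => b i - A i j)

theorem fmax_le_iff {n : ℕ} [NeZero n] {f : Fin n → ℝ} {a : ℝ} :
    fmax f ≤ a ↔ ∀ i, f i ≤ a := by
  simp [fmax]

theorem le_fmax {n : ℕ} [NeZero n] (f : Fin n → ℝ) (i : Fin n) : f i ≤ fmax f :=
  fmax_le_iff.1 le_rfl i

theorem le_fmin_iff {n : ℕ} [NeZero n] {f : Fin n → ℝ} {a : ℝ} :
    a ≤ fmin f ↔ ∀ i, a ≤ f i := by
  simp [fmin]

theorem fmin_le {n : ℕ} [NeZero n] (f : Fin n → ℝ) (i : Fin n) : fmin f ≤ f i :=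
  le_fmin_iff.1 le_rfl i

theorem dd_comm {M : ℕ} [NeZero M] (u v : Fin M → ℝ) : dd u v = dd v u := by
  simp only [dd, abs_sub_comm]

theorem mp_le_iff {M N : ℕ} [NeZero N] {A : Fin M → Fin N → ℝ} {x : Fin N → ℝ} {i : Fin M}
    {a : ℝ} : mp A x i ≤ a ↔ ∀ j, A i j + x j ≤ a :=
  fmax_le_iff

theorem le_mp {M N : ℕ} [NeZero N] (A : Fin M → Fin N → ℝ) (x : Fin N → ℝ) (i : Fin M)
    (j : Fin N) : A i j + x j ≤ mp A x i :=
  mp_le_iff.1 le_rfl j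

/-- If `x` exceeds `z` by at most `c` entrywise, so do their max-plus images. -/
theorem mp_le_add_mp {M N : ℕ} [NeZero N] (A : Fin M → Fin N → ℝ) {x z : Fin N → ℝ} {c : ℝ}
    (h : ∀ j, x j ≤ c + z j) (i : Fin M) : mp A x i ≤ c + mp A z i :=
  mp_le_iff.2 fun j => by linarith [h j, le_mp A z i j]

theorem mp_xbar_le {M N : ℕ} [NeZero M] [NeZero N] (A : Fin M → Fin N → ℝ) (b : Fin M → ℝ)
    (i : Fin M) : mp A (xbar A b) i ≤ b i :=
  mp_le_iff.2 fun j => by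
    have h : xbar A b j ≤ b i - A i j := fmin_le _ i
    linarith

theorem sub_mp_xbar_le_resid {M N : ℕ} [NeZero M] [NeZero N] (A : Fin M → Fin N → ℝ)
    (b : Fin M → ℝ) (i : Fin M) : b i - mp A (xbar A b) i ≤ resid A b :=
  le_fmax (fun i => b i - mp A (xbar A b) i) i

/-- The residual is at most twice the distance from `b` to any point of the column span. -/
theorem resid_le_two_mul_dd {M N : ℕ} [NeZero M] [NeZero N] (A : Fin M → Fin N → ℝ)
    (b : Fin M → ℝ) (z : Fin N → ℝ) : resid A b ≤ 2 * dd (mp A z) b := by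
  have hd (i : Fin M) := abs_le.1 (le_fmax (fun i => |mp A z i - b i|) i)
  change ∀ i, -dd (mp A z) b ≤ mp A z i - b i ∧ mp A z i - b i ≤ dd (mp A z) b at hd
  have hz (j : Fin N) : z j ≤ dd (mp A z) b + xbar A b j := by
    have h : z j - dd (mp A z) b ≤ xbar A b j :=
      le_fmin_iff.2 fun i => by linarith [(hd i).2, le_mp A z i j]
    linarith
  refine fmax_le_iff.2 fun i => ?_
  change b i - mp A (xbar A b) i ≤ _
  linarith [(hd i).1, mp_le_add_mp A hz i]

/-- The principal solution shifted by half the residual attains distance half the residual. -/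
theorem dd_mp_shifted_xbar_le {M N : ℕ} [NeZero M] [NeZero N] (A : Fin M → Fin N → ℝ)
    (b : Fin M → ℝ) :
    dd (mp A fun j => resid A b / 2 + xbar A b j) b ≤ resid A b / 2 := by
  refine fmax_le_iff.2 fun i => abs_le.2 ?_
  have hle := mp_le_add_mp A (x := fun j => resid A b / 2 + xbar A b j) (fun _ => le_rfl) i
  have hge := mp_le_add_mp A (x := xbar A b) (z := fun j => resid A b / 2 + xbar A b j)
    (c := -(resid A b / 2)) (fun j => by linarith) i
  constructor <;> linarith [mp_xbar_le A b i, sub_mp_xbar_le_resid A b i]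

/-- The shifted principal solution is a best Chebyshev approximation of `b`. -/
theorem dd_mp_shifted_xbar_le_dd_mp {M N : ℕ} [NeZero M] [NeZero N] (A : Fin M → Fin N → ℝ)
    (b : Fin M → ℝ) (z : Fin N → ℝ) :
    dd (mp A fun j => resid A b / 2 + xbar A b j) b ≤ dd (mp A z) b := by
  linarith [dd_mp_shifted_xbar_le A b, resid_le_two_mul_dd A b z]

/-- one full round of the alternating scheme does not increase the
two-sided approximation error. -/
theorem alternating_round_error_nonincreasing (M N L : ℕ) [NeZero M] [NeZero N] [NeZero L]
    (A : Fin M → Fin N → ℝ) (B : Fin M → Fin L → ℝ)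
    (x : Fin N → ℝ) (y : Fin L → ℝ)
    (y' : Fin L → ℝ) (hy' : y' = fun l => resid B (mp A x) / 2 + xbar B (mp A x) l)
    (x' : Fin N → ℝ) (hx' : x' = fun j => resid A (mp B y') / 2 + xbar A (mp B y') j) :
    dd (mp A x') (mp B y') ≤ dd (mp A x) (mp B y') ∧
      dd (mp A x) (mp B y') ≤ dd (mp A x) (mp B y) := by
  constructor
  · rw [hx']
    exact dd_mp_shifted_xbar_le_dd_mp A (mp B y') x
  · rw [hy', dd_comm _ (mp B _), dd_comm _ (mp B y)]
    exact dd_mp_shifted_xbar_le_dd_mp B (mp A x) y
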